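/- Rippa's leave-one-out cross-validation identity: let M be an invertible p×p real matrix (the interpolation matrix), f ∈ ℝᵖ (the sampled function values), and W = M⁻¹f (the interpolation weights). Fix an index i with (M⁻¹)ᵢᵢ ≠ 0, let M⁽ⁱ⁾ be the (p-1)×(p-1) matrix obtained from M by deleting row i and column i, f⁽ⁱ⁾ the vector obtained from f by deleting entry i, and W⁽ⁱ⁾ = (M⁽ⁱ⁾)⁻¹ f⁽ⁱ⁾ (the weights of the interpolant constructed without point i). Then the leave-one-out prediction error at point i satisfies fᵢ - Σ_{j≠i} Mᵢⱼ W⁽ⁱ⁾ⱼ = Wᵢ / (M⁻¹)ᵢᵢ, so each leave-one-out error can be computed from a single solve on the full dataset. -/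

import Mathlib

open Matrix

/-- A principal submatrix of an invertible matrix `M`, with row and column `i` deleted, is
invertible when the `i`-th diagonal entry of `M⁻¹` is nonzero. -/
theorem isUnit_det_submatrix_succAbove {K : Type*} [Field K] {p : ℕ}
    {M : Matrix (Fin (p + 1)) (Fin (p + 1)) K} {i : Fin (p + 1)} (h : M⁻¹ i i ≠ 0) :
    IsUnit (M.submatrix i.succAbove i.succAbove).det := by
  refine isUnit_iff_ne_zero.mpr fun h0 => h ?_
  rw [Matrix.inv_def, Matrix.smul_apply, Matrix.adjugate_fin_succ_eq_det_submatrix, h0,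
    mul_zero, smul_zero]

/-- Rippa's leave-one-out cross-validation identity: let `M` be an invertible interpolation
matrix (of size `p + 1`), `f` the sampled function values, `W = M⁻¹ f` the interpolation
weights. Fix an index `i` with `(M⁻¹)ᵢᵢ ≠ 0`, let `Mᵢ` be the matrix obtained from `M` by
deleting row `i` and column `i`, `fᵢ = f ∘ i.succAbove` the vector with entry `i` deleted,
and `Wᵢ = Mᵢ⁻¹ fᵢ` the weights of the interpolant constructed without point `i`. Then the
leave-one-out prediction error at point `i` satisfies
`fᵢ - ∑_{j ≠ i} Mᵢⱼ (Wᵢ)ⱼ = Wᵢ / (M⁻¹)ᵢᵢ`. -/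
theorem rippa_loocv_identity (p : ℕ) (M : Matrix (Fin (p + 1)) (Fin (p + 1)) ℝ)
    (hM : IsUnit M.det) (f : Fin (p + 1) → ℝ) (W : Fin (p + 1) → ℝ)
    (hW : W = M⁻¹.mulVec f) (i : Fin (p + 1)) (hMinv : M⁻¹ i i ≠ 0)
    (Mi : Matrix (Fin p) (Fin p) ℝ) (hMi : Mi = M.submatrix i.succAbove i.succAbove)
    (Wi : Fin p → ℝ) (hWi : Wi = Mi⁻¹.mulVec (f ∘ i.succAbove)) :
    f i - ∑ j, M i (i.succAbove j) * Wi j = W i / M⁻¹ i i := by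
  subst hW hMi hWi
  set N := M.submatrix i.succAbove i.succAbove with hN
  set Wi := N⁻¹ *ᵥ (f ∘ i.succAbove) with hWi
  have hNW : N *ᵥ Wi = f ∘ i.succAbove := by
    rw [hWi, mulVec_mulVec, mul_nonsing_inv _ (isUnit_det_submatrix_succAbove hMinv), one_mulVec]
  -- Extend the reduced weights by zero: the residual is supported at `i`.
  set V : Fin (p + 1) → ℝ := i.insertNth 0 Wi with hV
  set e := f i - ∑ j, M i (i.succAbove j) * Wi j with he
  have hMV (k : Fin (p + 1)) : (M *ᵥ V) k = ∑ j, M k (i.succAbove j) * Wi j := by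
    simp [mulVec, dotProduct, Fin.sum_univ_succAbove _ i, hV]
  have hres : f = M *ᵥ V + Pi.single i e := by
    funext k
    rw [Pi.add_apply, hMV]
    refine Fin.succAboveCases i ?_ (fun k => ?_) k
    · simp [he]
    · simpa [mulVec, dotProduct, hN] using (congrFun hNW k).symm
  have hW : (M⁻¹ *ᵥ f) i = e * M⁻¹ i i := by
    rw [hres, mulVec_add, mulVec_mulVec, nonsing_inv_mul _ hM, one_mulVec]
    simp [hV, mulVec_single, mul_comm]
  rw [eq_div_iff hMinv, hW]
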